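/- arXiv:2604.04365 — 3 statements merged into one kernel-verified Lean document; each statement's English description precedes it below -/
import Mathlib

section
/- Under the featured correlated Gaussian Wigner model G(n,d,ρ,r), let π' be a bijection with Hamming distance d(π*,π') = k, let σ = (π*)^{-1}∘π', let C1^E be the set of edges e of G1 with π'(e) = π*(e), let F = {v : π*(v) = π'(v)}, and let Y = φ(ρ)·Σ_{e∈E(G1)\C1^E} ( β_e(G1)·β_{π'(e)}(G2) − β_e(G1)·β_{π*(e)}(G2) ) + φ(r)·Σ_{v∉F} ( x_v^⊤ y_{π'(v)} − x_v^⊤ y_{π*(v)} ). Then for every 0 < t < 1, log E[exp(tY)] ≤ (1/2)·(N_k − k/2)·μ2^E(t) + (k/2)·μ2^V(t), where N_k = C(n,2) − C(n−k,2), μ2^E(t) = −(1/2)·log( 1 + (ρ²/(1−ρ²))·(4t − 4t²) ), and μ2^V(t) = −(d/2)·log( 1 + (r²/(1−r²))·(4t − 4t²) ). -/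
open MeasureTheory ProbabilityTheory Filter
open scoped ENNReal

namespace FCGW

/-- `phi x = x / (1 - x^2)`, the weight function `φ` from the paper. -/
noncomputable def phi (x : ℝ) : ℝ := x / (1 - x ^ 2)

/-- The edge set of the complete graph on `Fin n`: non-diagonal unordered pairs. -/
abbrev Edge (n : ℕ) := {e : Sym2 (Fin n) // ¬ e.IsDiag}

lemma map_not_isDiag {n : ℕ} (π : Equiv.Perm (Fin n)) (e : Sym2 (Fin n)) :
    ¬ e.IsDiag → ¬ (Sym2.map π e).IsDiag := by
  induction e using Sym2.ind with
  | _ x y =>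
    simp only [Sym2.map_pair_eq, Sym2.mk_isDiag_iff]
    exact fun he h => he (π.injective h)

/-- Action of a vertex permutation on edges: `π({u,v}) = {π(u), π(v)}`. -/
def edgeMap {n : ℕ} (π : Equiv.Perm (Fin n)) (e : Edge n) : Edge n :=
  ⟨Sym2.map π e.1, map_not_isDiag π e.1 e.2⟩

/-- The observation space: edge weights of `G1`, edge weights of `G2`,
features of `G1`, features of `G2`. -/
abbrev Obs (n d : ℕ) :=
  (Edge n → ℝ) × (Edge n → ℝ) × (Fin n → Fin d → ℝ) × (Fin n → Fin d → ℝ)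

/-- The law of a pair of jointly Gaussian standard normals with correlation `ρ`,
i.e. a centered Gaussian vector in `ℝ²` with covariance `[[1, ρ], [ρ, 1]]`. -/
noncomputable def gaussianPair (ρ : ℝ) : Measure (ℝ × ℝ) :=
  Measure.map (fun z : ℝ × ℝ => (z.1, ρ * z.1 + Real.sqrt (1 - ρ ^ 2) * z.2))
    ((gaussianReal 0 1).prod (gaussianReal 0 1))

/-- The law `N(0, Σ_d)` with `Σ_d = [[I_d, r I_d], [r I_d, I_d]]` of a correlated
feature pair `(x, y) ∈ ℝ^d × ℝ^d`. -/
noncomputable def featurePair (d : ℕ) (r : ℝ) : Measure ((Fin d → ℝ) × (Fin d → ℝ)) :=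
  Measure.map (fun z : (Fin d → ℝ) × (Fin d → ℝ) =>
      (z.1, fun i => r * z.1 i + Real.sqrt (1 - r ^ 2) * z.2 i))
    ((Measure.pi fun _ : Fin d => gaussianReal 0 1).prod
      (Measure.pi fun _ : Fin d => gaussianReal 0 1))

/-- The underlying randomness of the featured correlated Gaussian Wigner model:
independent correlated Gaussian pairs for each edge of `G1` and independent
correlated feature pairs for each vertex of `G1`. -/
noncomputable def sample (n d : ℕ) (ρ r : ℝ) :
    Measure ((Edge n → ℝ × ℝ) × (Fin n → (Fin d → ℝ) × (Fin d → ℝ))) :=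
  (Measure.pi fun _ : Edge n => gaussianPair ρ).prod
    (Measure.pi fun _ : Fin n => featurePair d r)

/-- The observations `(β(G1), β(G2), x, y)` produced from the underlying
randomness when the latent vertex correspondence is `πs`: the pair at edge `e`
gives the weight of `e` in `G1` and of `πs(e)` in `G2`, and the feature pair at a
vertex `v` gives the feature of `v` in `G1` and of `πs(v)` in `G2`. -/
noncomputable def obsOf {n d : ℕ} (πs : Equiv.Perm (Fin n))
    (ω : (Edge n → ℝ × ℝ) × (Fin n → (Fin d → ℝ) × (Fin d → ℝ))) : Obs n d :=
  (fun e => (ω.1 e).1,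
   fun f => (ω.1 (edgeMap πs⁻¹ f)).2,
   fun v => (ω.2 v).1,
   fun v => (ω.2 (πs⁻¹ v)).2)

/-- The law of the observed pair of featured graphs `(G1, G2)` under the featured
correlated Gaussian Wigner model `G(n, d, ρ, r)` with latent correspondence `πs`. -/
noncomputable def obsLaw (n d : ℕ) (ρ r : ℝ) (πs : Equiv.Perm (Fin n)) :
    Measure (Obs n d) :=
  Measure.map (obsOf πs) (sample n d ρ r)

/-- The similarity score
`S_π = φ(ρ) Σ_e β_e(G1) β_{π(e)}(G2) + φ(r) Σ_v ⟪x_v, y_{π(v)}⟫`. -/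
noncomputable def score {n d : ℕ} (ρ r : ℝ) (o : Obs n d) (π : Equiv.Perm (Fin n)) : ℝ :=
  phi ρ * ∑ e : Edge n, o.1 e * o.2.1 (edgeMap π e)
    + phi r * ∑ v : Fin n, ∑ i : Fin d, o.2.2.1 v i * o.2.2.2 (π v) i

/-- `overlap(π, π') = |{v : π v = π' v}| / n`. -/
noncomputable def overlap {n : ℕ} (π π' : Equiv.Perm (Fin n)) : ℝ :=
  ((Finset.univ.filter fun v => π v = π' v).card : ℝ) / n

/-- The Hamming distance `d(π, π') = |{v : π v ≠ π' v}|`. -/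
def hamming {n : ℕ} (π π' : Equiv.Perm (Fin n)) : ℕ :=
  (Finset.univ.filter fun v => π v ≠ π' v).card

instance {n : ℕ} : MeasurableSpace (Equiv.Perm (Fin n)) := ⊤

/-- The Bayesian joint law of `(π*, (G1, G2))` when `π*` is uniform on `S_n`. -/
noncomputable def bayesLaw (n d : ℕ) (ρ r : ℝ) :
    Measure (Equiv.Perm (Fin n) × Obs n d) :=
  (Nat.factorial n : ℝ≥0∞)⁻¹ •
    ∑ π : Equiv.Perm (Fin n), Measure.map (fun o => (π, o)) (obsLaw n d ρ r π)

lemma spec_aux {ι : Type*} [Fintype ι] [DecidableEq ι] (σ : Equiv.Perm ι) :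
    ∃ (l : ι → ℝ) (b : OrthonormalBasis ι ℝ (EuclideanSpace ℝ ι)),
      (∀ i, 0 ≤ l i ∧ l i ≤ 1) ∧
      (∑ i, l i = ((Finset.univ.filter fun i => σ i ≠ i).card : ℝ) / 2) ∧
      ∀ c : ι → ℝ, ∑ e, ((∑ i, c i • b i : EuclideanSpace ℝ ι) (σ e)
        - (∑ i, c i • b i : EuclideanSpace ℝ ι) e) ^ 2 = 4 * ∑ i, l i * c i ^ 2 := by
  let H : Matrix ι ι ℝ := Matrix.of fun i j =>
    ((if i = j then 2 else 0) - (if σ i = j then 1 else 0) - (if σ j = i then 1 else 0)) / 4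
  have hH : H.IsHermitian := by
    ext i j
    simp only [H, Matrix.conjTranspose_apply, Matrix.of_apply, star_trivial, eq_comm (a := i) (b := j)]
    ring
  have hmul : ∀ (x : ι → ℝ) e, (H.mulVec x) e = (2 * x e - x (σ e) - x (σ.symm e)) / 4 := by
    intro x e
    have : ∀ j, (σ j = e) ↔ (j = σ.symm e) := fun j => by rw [Equiv.eq_symm_apply]
    simp only [H, Matrix.mulVec, dotProduct, Matrix.of_apply, this]
    simp [div_mul_eq_mul_div, ← Finset.sum_div, sub_mul, Finset.sum_sub_distrib]
  have hquad : ∀ x : ι → ℝ, ∑ e, (x (σ e) - x e) ^ 2 = 4 * (x ⬝ᵥ H.mulVec x) := by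
    intro x
    simp only [dotProduct, hmul]
    have h1 : ∑ e, x (σ e) ^ 2 = ∑ e, x e ^ 2 := Equiv.sum_comp σ (fun e => x e ^ 2)
    have h2 : ∑ e, x e * x (σ.symm e) = ∑ e, x (σ e) * x e := by
      rw [← Equiv.sum_comp σ]; simp
    have e1 : ∑ e, (x (σ e) - x e) ^ 2
        = ∑ e, x (σ e) ^ 2 - 2 * ∑ e, x (σ e) * x e + ∑ e, x e ^ 2 := by
      rw [Finset.mul_sum, ← Finset.sum_sub_distrib, ← Finset.sum_add_distrib]
      exact Finset.sum_congr rfl fun _ _ => by ring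
    have e2 : 4 * ∑ e, x e * ((2 * x e - x (σ e) - x (σ.symm e)) / 4)
        = 2 * ∑ e, x e ^ 2 - ∑ e, x (σ e) * x e - ∑ e, x e * x (σ.symm e) := by
      rw [Finset.mul_sum, Finset.mul_sum, ← Finset.sum_sub_distrib, ← Finset.sum_sub_distrib]
      exact Finset.sum_congr rfl fun _ _ => by ring
    rw [e1, e2, h1, h2]; ring
  have hdiag : ∀ c : ι → ℝ, ∑ e, ((∑ i, c i • hH.eigenvectorBasis i : EuclideanSpace ℝ ι) (σ e)
        - (∑ i, c i • hH.eigenvectorBasis i : EuclideanSpace ℝ ι) e) ^ 2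
        = 4 * ∑ i, hH.eigenvalues i * c i ^ 2 := by
    intro c
    rw [hquad]
    congr 1
    have hm : H.mulVec (∑ i, c i • hH.eigenvectorBasis i : EuclideanSpace ℝ ι)
        = (∑ i, (c i * hH.eigenvalues i) • hH.eigenvectorBasis i : EuclideanSpace ℝ ι) := by
      have : ∀ c : ι → ℝ, ((∑ i, c i • hH.eigenvectorBasis i : EuclideanSpace ℝ ι) : ι → ℝ)
          = ∑ i, c i • (hH.eigenvectorBasis i : ι → ℝ) := by
        intro c; ext e; simp
      rw [this, this, Matrix.mulVec_sum]
      refine Finset.sum_congr rfl fun i _ => ?_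
      rw [Matrix.mulVec_smul, hH.mulVec_eigenvectorBasis, smul_smul]
    rw [hm]
    have := hH.eigenvectorBasis.orthonormal.inner_sum (𝕜 := ℝ) (fun i => c i * hH.eigenvalues i) c Finset.univ
    simp only [EuclideanSpace.inner_eq_star_dotProduct, star_trivial, conj_trivial] at this
    rw [this]
    exact Finset.sum_congr rfl fun i _ => by ring
  refine ⟨hH.eigenvalues, hH.eigenvectorBasis, ?_, ?_, hdiag⟩
  · intro i
    have h := hdiag (Pi.single i 1)
    have hs : (∑ j, (Pi.single i 1 : ι → ℝ) j • hH.eigenvectorBasis j) = hH.eigenvectorBasis i := by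
      rw [Finset.sum_eq_single i] <;> simp +contextual
    have hs2 : ∑ j, hH.eigenvalues j * (Pi.single i 1 : ι → ℝ) j ^ 2 = hH.eigenvalues i := by
      rw [Finset.sum_eq_single i] <;> simp +contextual
    rw [hs, hs2] at h
    set x := hH.eigenvectorBasis i
    have hn : ∑ e, x e ^ 2 = 1 := by
      have : ‖x‖ = 1 := hH.eigenvectorBasis.orthonormal.1 i
      have h2 := EuclideanSpace.norm_sq_eq x
      rw [this] at h2
      simpa using h2.symm
    have h1 : ∑ e, x (σ e) ^ 2 = ∑ e, x e ^ 2 := Equiv.sum_comp σ (fun e => x e ^ 2)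
    have hle : ∑ e, (x (σ e) - x e) ^ 2 ≤ 2 * ∑ e, x (σ e) ^ 2 + 2 * ∑ e, x e ^ 2 := by
      rw [Finset.mul_sum, Finset.mul_sum, ← Finset.sum_add_distrib]
      exact Finset.sum_le_sum fun e _ => by nlinarith [sq_nonneg (x (σ e) + x e)]
    have h0 : 0 ≤ ∑ e, (x (σ e) - x e) ^ 2 := Finset.sum_nonneg fun _ _ => sq_nonneg _
    rw [h1, hn] at hle
    constructor <;> linarith
  · have := hH.trace_eq_sum_eigenvalues
    simp only [RCLike.ofReal_real_eq_id, id] at this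
    rw [← this]
    simp only [Matrix.trace, Matrix.diag, H, Matrix.of_apply, Finset.card_filter]
    push_cast
    rw [Finset.sum_div]
    refine Finset.sum_congr rfl fun i _ => ?_
    by_cases h : σ i = i <;> simp [h] <;> norm_num

lemma lint_lin (c : ℝ) : ∫⁻ z, ENNReal.ofReal (Real.exp (c * z)) ∂(gaussianReal 0 1)
    = ENNReal.ofReal (Real.exp (c ^ 2 / 2)) := by
  rw [← ofReal_integral_eq_lintegral_ofReal (integrable_exp_mul_gaussianReal c)
    (ae_of_all _ fun _ => (Real.exp_pos _).le)]
  congr 1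
  have := congrFun (mgf_fun_id_gaussianReal (μ := 0) (v := 1)) c
  simpa [mgf] using this

lemma int_sq {q : ℝ} (hq : 0 ≤ q) : ∫ z, Real.exp (-(q / 2) * z ^ 2) ∂(gaussianReal 0 1)
    = (Real.sqrt (1 + q))⁻¹ := by
  rw [integral_gaussianReal_eq_integral_smul one_ne_zero]
  simp only [gaussianPDFReal, smul_eq_mul]
  have : ∀ x : ℝ, (√(2 * Real.pi * (1 : NNReal)))⁻¹ * Real.exp (-(x - 0) ^ 2 / (2 * (1 : NNReal))) *
      Real.exp (-(q / 2) * x ^ 2)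
      = (√(2 * Real.pi))⁻¹ * Real.exp (-((1 + q) / 2) * x ^ 2) := by
    intro x
    rw [mul_assoc, ← Real.exp_add]
    simp only [NNReal.coe_one, mul_one, sub_zero]
    congr 2; ring
  simp_rw [this]
  rw [integral_const_mul, integral_gaussian, ← Real.sqrt_inv, ← Real.sqrt_inv,
    ← Real.sqrt_mul (by positivity)]
  congr 1
  have := Real.pi_pos
  field_simp

lemma integrable_sq {q : ℝ} (hq : 0 ≤ q) :
    Integrable (fun z => Real.exp (-(q / 2) * z ^ 2)) (gaussianReal 0 1) := by
  refine Integrable.of_bound (by fun_prop) 1 (ae_of_all _ fun z => ?_)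
  rw [Real.norm_eq_abs, abs_of_pos (Real.exp_pos _), Real.exp_le_one_iff]
  have : 0 ≤ q / 2 * z ^ 2 := by positivity
  linarith

/-- standard Gaussian on a finite product -/
noncomputable abbrev gam (ι : Type*) [Fintype ι] : Measure (ι → ℝ) :=
  Measure.pi fun _ : ι => gaussianReal 0 1

lemma lint_lin_pi {ι : Type*} [Fintype ι] (c : ι → ℝ) :
    ∫⁻ z, ENNReal.ofReal (Real.exp (∑ i, c i * z i)) ∂(gam ι)
      = ENNReal.ofReal (Real.exp ((∑ i, c i ^ 2) / 2)) := by
  simp_rw [Real.exp_sum]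
  rw [← ofReal_integral_eq_lintegral_ofReal]
  · rw [integral_fintype_prod_eq_prod (f := fun i z => Real.exp (c i * z)), Finset.sum_div, Real.exp_sum]
    congr 1
    refine Finset.prod_congr rfl fun i _ => ?_
    have := congrFun (mgf_fun_id_gaussianReal (μ := 0) (v := 1)) (c i)
    simpa [mgf] using this
  · exact Integrable.fintype_prod (f := fun i z => Real.exp (c i * z)) fun i => integrable_exp_mul_gaussianReal (c i)
  · exact ae_of_all _ fun _ => Finset.prod_nonneg fun _ _ => (Real.exp_pos _).le

lemma lint_quad_pi {ι : Type*} [Fintype ι] [DecidableEq ι] (σ : Equiv.Perm ι) {s : ℝ} (hs : 0 ≤ s) :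
    ∃ V : ℝ, 0 < V ∧
      Real.log V ≤ -(((Finset.univ.filter fun i => σ i ≠ i).card : ℝ) / 4) * Real.log (1 + s) ∧
      ∫⁻ a, ENNReal.ofReal (Real.exp (-(s / 8) * ∑ e, (a (σ e) - a e) ^ 2)) ∂(gam ι)
        = ENNReal.ofReal V := by
  obtain ⟨l, b, hl, htr, hq⟩ := spec_aux σ
  have hp : ∀ i, 0 < 1 + s * l i := fun i => by
    have := mul_nonneg hs (hl i).1; linarith
  refine ⟨∏ i, (Real.sqrt (1 + s * l i))⁻¹, ?_, ?_, ?_⟩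
  · exact Finset.prod_pos fun i _ => inv_pos.2 (Real.sqrt_pos.2 (hp i))
  · rw [Real.log_prod (fun i _ => (inv_pos.2 (Real.sqrt_pos.2 (hp i))).ne')]
    have : -(((Finset.univ.filter fun i => σ i ≠ i).card : ℝ) / 4) * Real.log (1 + s)
        = ∑ i, -(l i * Real.log (1 + s) / 2) := by
      rw [Finset.sum_neg_distrib, ← Finset.sum_div, ← Finset.sum_mul, htr]; ring
    rw [this]
    refine Finset.sum_le_sum fun i _ => ?_
    rw [Real.log_inv, Real.log_sqrt (hp i).le]
    have h1 := rpow_one_add_le_one_add_mul_self (s := s) (by linarith) (hl i).1 (hl i).2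
    have h2 := Real.log_le_log (Real.rpow_pos_of_pos (by linarith) _) h1
    rw [Real.log_rpow (by linarith), mul_comm (l i) s] at h2
    linarith
  · have hE := (map_pi_eq_stdGaussian (ι := ι)).trans (stdGaussian_eq_map_pi_orthonormalBasis b)
    have hF : Measurable fun x : EuclideanSpace ℝ ι =>
        ENNReal.ofReal (Real.exp (-(s / 8) * ∑ e, (x (σ e) - x e) ^ 2)) := by fun_prop
    have h1 := congrArg (fun μ => ∫⁻ x, ENNReal.ofReal (Real.exp (-(s / 8) * ∑ e, (x (σ e) - x e) ^ 2)) ∂μ) hE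
    simp only at h1
    rw [lintegral_map hF (by fun_prop), lintegral_map hF (by fun_prop)] at h1
    refine h1.trans ?_
    simp_rw [hq]
    have h3 : ∀ a : ι → ℝ, Real.exp (-(s / 8) * (4 * ∑ i, l i * a i ^ 2))
        = ∏ i, Real.exp (-(s * l i / 2) * a i ^ 2) := by
      intro a
      rw [← Real.exp_sum, Finset.mul_sum, Finset.mul_sum]
      congr 1
      exact Finset.sum_congr rfl fun _ _ => by ring
    simp_rw [h3]
    rw [← ofReal_integral_eq_lintegral_ofReal]
    · rw [integral_fintype_prod_eq_prod (f := fun i z => Real.exp (-(s * l i / 2) * z ^ 2))]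
      congr 1
      exact Finset.prod_congr rfl fun i _ => int_sq (mul_nonneg hs (hl i).1)
    · exact Integrable.fintype_prod (f := fun i z => Real.exp (-(s * l i / 2) * z ^ 2))
        fun i => integrable_sq (mul_nonneg hs (hl i).1)
    · exact ae_of_all _ fun _ => Finset.prod_nonneg fun _ _ => (Real.exp_pos _).le

lemma lint_pair {ι : Type*} [Fintype ι] [DecidableEq ι] (σ : Equiv.Perm ι) {ρ t : ℝ} (hρ : 0 < ρ ∧ ρ < 1) (ht : 0 < t) (ht1 : t < 1) :
    ∃ V : ℝ, 0 < V ∧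
      Real.log V ≤ -(((Finset.univ.filter fun i => σ i ≠ i).card : ℝ) / 4) *
        Real.log (1 + ρ ^ 2 / (1 - ρ ^ 2) * (4 * t - 4 * t ^ 2)) ∧
      ∫⁻ p, ENNReal.ofReal (Real.exp (t * (phi ρ * ∑ e, (p.1 e * (ρ * p.1 (σ e) + √(1 - ρ ^ 2) * p.2 (σ e))
        - p.1 e * (ρ * p.1 e + √(1 - ρ ^ 2) * p.2 e))))) ∂((gam ι).prod (gam ι))
        = ENNReal.ofReal V := by
  have hρ2 : 0 < 1 - ρ ^ 2 := by nlinarith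
  have hs : 0 ≤ ρ ^ 2 / (1 - ρ ^ 2) * (4 * t - 4 * t ^ 2) := by
    have : 0 ≤ 4 * t - 4 * t ^ 2 := by nlinarith
    positivity
  obtain ⟨V, hV, hV1, hV2⟩ := lint_quad_pi σ hs
  refine ⟨V, hV, hV1, ?_⟩
  rw [lintegral_prod _ (by fun_prop), ← hV2]
  refine lintegral_congr fun a => ?_
  have hsum : ∀ z : ι → ℝ, t * (phi ρ * ∑ e, (a e * (ρ * a (σ e) + √(1 - ρ ^ 2) * z (σ e))
        - a e * (ρ * a e + √(1 - ρ ^ 2) * z e)))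
      = t * phi ρ * ρ * (∑ e, (a e * a (σ e) - a e ^ 2)) +
        ∑ e, (t * phi ρ * √(1 - ρ ^ 2) * (a (σ.symm e) - a e)) * z e := by
    intro z
    have h2 : ∑ e, a (σ.symm e) * z e = ∑ e, a e * z (σ e) := by
      rw [← Equiv.sum_comp σ]; simp
    have h3 : ∑ e, (t * phi ρ * √(1 - ρ ^ 2) * (a (σ.symm e) - a e)) * z e
        = t * phi ρ * √(1 - ρ ^ 2) * (∑ e, a (σ.symm e) * z e - ∑ e, a e * z e) := by
      rw [← Finset.sum_sub_distrib, Finset.mul_sum]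
      exact Finset.sum_congr rfl fun _ _ => by ring
    rw [h3, h2, ← Finset.sum_sub_distrib, Finset.mul_sum, Finset.mul_sum, Finset.mul_sum, Finset.mul_sum,
      ← Finset.sum_add_distrib]
    exact Finset.sum_congr rfl fun _ _ => by ring
  simp_rw [hsum, Real.exp_add, ENNReal.ofReal_mul (Real.exp_pos _).le]
  rw [lintegral_const_mul _ (by fun_prop), lint_lin_pi, ← ENNReal.ofReal_mul (Real.exp_pos _).le,
    ← Real.exp_add]
  congr 2
  have h1 : ∑ e, a (σ e) ^ 2 = ∑ e, a e ^ 2 := Equiv.sum_comp σ (fun e => a e ^ 2)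
  have h4 : ∑ e, (a e * a (σ e) - a e ^ 2) = -(1 / 2) * ∑ e, (a (σ e) - a e) ^ 2 := by
    have : ∑ e, (a (σ e) - a e) ^ 2 = ∑ e, a (σ e) ^ 2 + ∑ e, a e ^ 2 - 2 * ∑ e, a e * a (σ e) := by
      rw [Finset.mul_sum, ← Finset.sum_add_distrib, ← Finset.sum_sub_distrib]
      exact Finset.sum_congr rfl fun _ _ => by ring
    rw [this, h1, Finset.sum_sub_distrib]; ring
  have h5 : ∑ e, (t * phi ρ * √(1 - ρ ^ 2) * (a (σ.symm e) - a e)) ^ 2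
      = (t * phi ρ) ^ 2 * (1 - ρ ^ 2) * ∑ e, (a (σ e) - a e) ^ 2 := by
    have : ∑ e, (a (σ e) - a e) ^ 2 = ∑ e, (a (σ.symm e) - a e) ^ 2 := by
      rw [← Equiv.sum_comp σ (fun e => (a (σ.symm e) - a e) ^ 2)]
      exact Finset.sum_congr rfl fun _ _ => by simp; ring
    rw [this, Finset.mul_sum]
    refine Finset.sum_congr rfl fun _ _ => ?_
    rw [mul_pow, mul_pow, Real.sq_sqrt hρ2.le]
  rw [h4, h5, phi]
  field_simp
  ring

lemma mp_edge (ι : Type*) [Fintype ι] (ρ : ℝ) :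
    MeasurePreserving (fun (p : (ι → ℝ) × (ι → ℝ)) (e : ι) =>
        ((p.1 e, ρ * p.1 e + √(1 - ρ ^ 2) * p.2 e) : ℝ × ℝ))
      ((gam ι).prod (gam ι)) (Measure.pi fun _ : ι => gaussianPair ρ) := by
  have h1 := (measurePreserving_arrowProdEquivProdArrow ℝ ℝ ι (fun _ => gaussianReal 0 1)
    (fun _ => gaussianReal 0 1)).symm
  have hm : Measurable (fun z : ℝ × ℝ => (z.1, ρ * z.1 + √(1 - ρ ^ 2) * z.2)) := by fun_prop
  have : IsProbabilityMeasure (((gaussianReal 0 1).prod (gaussianReal 0 1)).map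
    (fun z : ℝ × ℝ => (z.1, ρ * z.1 + √(1 - ρ ^ 2) * z.2))) :=
    Measure.isProbabilityMeasure_map hm.aemeasurable
  have h2 : MeasurePreserving (fun (x : ι → ℝ × ℝ) i => ((x i).1, ρ * (x i).1 + √(1 - ρ ^ 2) * (x i).2))
      (Measure.pi fun _ : ι => (gaussianReal 0 1).prod (gaussianReal 0 1))
      (Measure.pi fun _ : ι => gaussianPair ρ) :=
    ⟨by fun_prop, Measure.pi_map_pi (fun _ => hm.aemeasurable)⟩
  exact h2.comp h1

lemma mp_curry (n d : ℕ) :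
    MeasurePreserving (fun (p : Fin n × Fin d → ℝ) (v : Fin n) (i : Fin d) => p (v, i))
      (gam (Fin n × Fin d)) (Measure.pi fun _ : Fin n => gam (Fin d)) := by
  refine ⟨by fun_prop, ?_⟩
  have := Measure.infinitePi_map_curry (fun (_ : Fin n) (_ : Fin d) => gaussianReal 0 1)
  simp only [Measure.infinitePi_eq_pi] at this
  exact this

instance instFeat (d : ℕ) (r : ℝ) : IsProbabilityMeasure (featurePair d r) :=
  Measure.isProbabilityMeasure_map (by fun_prop)

instance instGP (r : ℝ) : IsProbabilityMeasure (gaussianPair r) :=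
  Measure.isProbabilityMeasure_map (by fun_prop)

lemma mp_feat (n d : ℕ) (r : ℝ) :
    MeasurePreserving (fun (p : (Fin n × Fin d → ℝ) × (Fin n × Fin d → ℝ)) (v : Fin n) =>
        ((fun i => p.1 (v, i), fun i => r * p.1 (v, i) + √(1 - r ^ 2) * p.2 (v, i)) :
          (Fin d → ℝ) × (Fin d → ℝ)))
      ((gam (Fin n × Fin d)).prod (gam (Fin n × Fin d)))
      (Measure.pi fun _ : Fin n => featurePair d r) := by
  have h0 := (mp_curry n d).prod (mp_curry n d)
  have h1 := (measurePreserving_arrowProdEquivProdArrow (Fin d → ℝ) (Fin d → ℝ) (Fin n)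
    (fun _ => gam (Fin d)) (fun _ => gam (Fin d))).symm
  have hm : Measurable (fun z : (Fin d → ℝ) × (Fin d → ℝ) =>
      (z.1, fun i => r * z.1 i + √(1 - r ^ 2) * z.2 i)) := by fun_prop
  have : IsProbabilityMeasure (((gam (Fin d)).prod (gam (Fin d))).map
    (fun z : (Fin d → ℝ) × (Fin d → ℝ) => (z.1, fun i => r * z.1 i + √(1 - r ^ 2) * z.2 i))) :=
    Measure.isProbabilityMeasure_map hm.aemeasurable
  have h2 : MeasurePreserving (fun (x : Fin n → (Fin d → ℝ) × (Fin d → ℝ)) v =>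
        (((x v).1, fun i => r * (x v).1 i + √(1 - r ^ 2) * (x v).2 i) : (Fin d → ℝ) × (Fin d → ℝ)))
      (Measure.pi fun _ : Fin n => (gam (Fin d)).prod (gam (Fin d)))
      (Measure.pi fun _ : Fin n => featurePair d r) :=
    ⟨by fun_prop, Measure.pi_map_pi (fun _ => hm.aemeasurable)⟩
  exact h2.comp (h1.comp h0)

lemma edgeMap_mul {n : ℕ} (a b : Equiv.Perm (Fin n)) (e : Edge n) :
    edgeMap a (edgeMap b e) = edgeMap (a * b) e := by
  apply Subtype.ext
  simp [edgeMap, Sym2.map_map]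

lemma edgeMap_one {n : ℕ} (e : Edge n) : edgeMap 1 e = e := by
  apply Subtype.ext
  simp [edgeMap]

/-- edge permutation induced by a vertex permutation -/
def edgePerm {n : ℕ} (s : Equiv.Perm (Fin n)) : Equiv.Perm (Edge n) where
  toFun := edgeMap s
  invFun := edgeMap s⁻¹
  left_inv e := by rw [edgeMap_mul, inv_mul_cancel, edgeMap_one]
  right_inv e := by rw [edgeMap_mul, mul_inv_cancel, edgeMap_one]

lemma card_swapped {n : ℕ} (s : Equiv.Perm (Fin n)) :
    (Finset.univ.filter fun e : Edge n => edgeMap s e = e ∧ ∃ v ∈ e.1, s v ≠ v).card * 2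
      ≤ (Finset.univ.filter fun v => s v ≠ v).card * 1 := by
  classical
  apply Finset.card_mul_le_card_mul (fun (e : Edge n) v => v ∈ e.1)
  · rintro ⟨e, hne⟩ he
    simp only [Finset.mem_filter, Finset.mem_univ, true_and] at he
    obtain ⟨h1, v, hv, hsv⟩ := he
    have h1' : Sym2.map s e = e := congrArg Subtype.val h1
    have h2 : s v ∈ e := by
      rw [← h1']; exact Sym2.mem_map.2 ⟨v, hv, rfl⟩
    have hsub : ({v, s v} : Finset (Fin n)) ⊆
        (Finset.univ.filter fun v => s v ≠ v).bipartiteAbove (fun (e : Edge n) v => v ∈ e.1) ⟨e, hne⟩ := by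
      intro w hw
      simp only [Finset.mem_insert, Finset.mem_singleton] at hw
      simp only [Finset.mem_bipartiteAbove, Finset.mem_filter, Finset.mem_univ, true_and]
      rcases hw with rfl | rfl
      · exact ⟨hsv, hv⟩
      · exact ⟨fun h => hsv (s.injective h), h2⟩
    calc 2 = ({v, s v} : Finset (Fin n)).card := (Finset.card_pair (Ne.symm hsv)).symm
      _ ≤ _ := Finset.card_le_card hsub
  · intro v hv
    simp only [Finset.mem_filter, Finset.mem_univ, true_and] at hv
    rw [Finset.card_le_one]
    have key : ∀ e ∈ (Finset.univ.filter fun e : Edge n => edgeMap s e = e ∧ ∃ v ∈ e.1, s v ≠ v).bipartiteBelow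
        (fun (e : Edge n) v => v ∈ e.1) v, e.1 = s(v, s v) := by
      rintro ⟨e, hne⟩ he
      simp only [Finset.mem_bipartiteBelow, Finset.mem_filter, Finset.mem_univ, true_and] at he
      have h1' : Sym2.map s e = e := congrArg Subtype.val he.1.1
      have h2 : s v ∈ e := by
        rw [← h1']; exact Sym2.mem_map.2 ⟨v, he.2, rfl⟩
      exact (Sym2.mem_and_mem_iff (Ne.symm hv)).1 ⟨he.2, h2⟩
    intro a ha b hb
    exact Subtype.ext ((key a ha).trans (key b hb).symm)

lemma card_bothfixed {n : ℕ} (s : Equiv.Perm (Fin n)) :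
    (Finset.univ.filter fun e : Edge n => ∀ v ∈ e.1, s v = v).card
      ≤ ((Finset.univ.filter fun v => s v = v).card).choose 2 := by
  classical
  rw [← Sym2.card_image_offDiag]
  refine Finset.card_le_card_of_injOn Subtype.val ?_ Subtype.val_injective.injOn
  rintro ⟨e, hne⟩ he
  induction e using Sym2.ind with
  | _ x y =>
    simp only [Finset.coe_filter, Finset.mem_univ, true_and, Set.mem_setOf_eq, Sym2.mem_iff, forall_eq_or_imp,
      forall_eq] at he
    simp only [Finset.coe_image, Set.mem_image, Finset.mem_coe, Finset.mem_offDiag, Finset.mem_filter,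
      Finset.mem_univ, true_and]
    exact ⟨(x, y), ⟨he.1, he.2, fun h => hne (by simpa using h)⟩, rfl⟩

lemma card_edges {n : ℕ} (s : Equiv.Perm (Fin n)) (k : ℕ)
    (hk : (Finset.univ.filter fun v => s v ≠ v).card = k) :
    ((n.choose 2 : ℝ) - ((n - k).choose 2 : ℝ)) - (k : ℝ) / 2
      ≤ ((Finset.univ.filter fun e : Edge n => edgePerm s e ≠ e).card : ℝ) := by
  classical
  have h1 := card_swapped s
  have h2 := card_bothfixed s
  have h3 : (Finset.univ.filter fun v => s v = v).card = n - k := by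
    have := Finset.card_filter_add_card_filter_not (s := (Finset.univ : Finset (Fin n))) (fun v => s v = v)
    simp only [Finset.card_univ, Fintype.card_fin] at this
    have h : (Finset.univ.filter fun v => ¬ s v = v).card = k := hk
    omega
  have h4 : (Finset.univ.filter fun e : Edge n => edgeMap s e = e).card
      ≤ (Finset.univ.filter fun e : Edge n => ∀ v ∈ e.1, s v = v).card +
        (Finset.univ.filter fun e : Edge n => edgeMap s e = e ∧ ∃ v ∈ e.1, s v ≠ v).card := by
    refine le_trans (Finset.card_le_card ?_) (Finset.card_union_le _ _)
    intro e he
    simp only [Finset.mem_filter, Finset.mem_univ, true_and, Finset.mem_union] at he ⊢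
    by_cases h : ∀ v ∈ e.1, s v = v
    · exact Or.inl h
    · push Not at h
      exact Or.inr ⟨he, h⟩
  have h5 := Finset.card_filter_add_card_filter_not (s := (Finset.univ : Finset (Edge n))) (fun e => edgeMap s e = e)
  have h6 : (Finset.univ : Finset (Edge n)).card = n.choose 2 := by
    have := Sym2.card_subtype_not_diag (α := Fin n)
    rw [Fintype.card_fin] at this
    rw [← this, Finset.card_univ]
  have h7 : (Finset.univ.filter fun e : Edge n => ¬ edgeMap s e = e).card
    = (Finset.univ.filter fun e : Edge n => edgePerm s e ≠ e).card := rfl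
  rw [h6, h7] at h5
  rw [h3] at h2
  rw [hk] at h1
  have h8 : 2 * n.choose 2 ≤ 2 * (n - k).choose 2 + k +
    2 * (Finset.univ.filter fun e : Edge n => edgePerm s e ≠ e).card := by omega
  have h9 : (2 : ℝ) * n.choose 2 ≤ 2 * (n - k).choose 2 + k +
    2 * (Finset.univ.filter fun e : Edge n => edgePerm s e ≠ e).card := by exact_mod_cast h8
  linarith

lemma edge_final (n : ℕ) (s : Equiv.Perm (Fin n)) {ρ t : ℝ} (hρ : 0 < ρ ∧ ρ < 1)
    (ht : 0 < t) (ht1 : t < 1) (k : ℕ)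
    (hk : (Finset.univ.filter fun v => s v ≠ v).card = k) :
    ∃ V : ℝ, 0 < V ∧
      Real.log V ≤ 1 / 2 * (((n.choose 2 : ℝ) - ((n - k).choose 2 : ℝ)) - (k : ℝ) / 2) *
          (-(1 / 2) * Real.log (1 + ρ ^ 2 / (1 - ρ ^ 2) * (4 * t - 4 * t ^ 2))) ∧
      ∫⁻ w, ENNReal.ofReal (Real.exp (t * (phi ρ * ∑ e : Edge n,
        ((w e).1 * (w (edgeMap s e)).2 - (w e).1 * (w e).2))))
        ∂(Measure.pi fun _ : Edge n => gaussianPair ρ) = ENNReal.ofReal V := by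
  obtain ⟨V, hV, hV1, hV2⟩ := lint_pair (edgePerm s) hρ ht ht1
  refine ⟨V, hV, hV1.trans ?_, ?_⟩
  · have hρ2 : 0 < 1 - ρ ^ 2 := by nlinarith
    have hs : 0 ≤ ρ ^ 2 / (1 - ρ ^ 2) * (4 * t - 4 * t ^ 2) := by
      have : 0 ≤ 4 * t - 4 * t ^ 2 := by nlinarith
      positivity
    have hl := Real.log_nonneg (show 1 ≤ 1 + ρ ^ 2 / (1 - ρ ^ 2) * (4 * t - 4 * t ^ 2) by linarith)
    have hc := card_edges s k hk
    have := mul_le_mul_of_nonneg_right hc hl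
    linarith
  · rw [← (mp_edge (Edge n) ρ).lintegral_comp (by fun_prop), ← hV2]
    rfl

lemma feat_final (n d : ℕ) (s : Equiv.Perm (Fin n)) {r t : ℝ} (hr : 0 < r ∧ r < 1)
    (ht : 0 < t) (ht1 : t < 1) (k : ℕ)
    (hk : (Finset.univ.filter fun v => s v ≠ v).card = k) :
    ∃ V : ℝ, 0 < V ∧
      Real.log V ≤ (k : ℝ) / 2 *
          (-((d : ℝ) / 2) * Real.log (1 + r ^ 2 / (1 - r ^ 2) * (4 * t - 4 * t ^ 2))) ∧
      ∫⁻ w, ENNReal.ofReal (Real.exp (t * (phi r * ∑ v : Fin n,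
        ((∑ i : Fin d, (w v).1 i * (w (s v)).2 i) - ∑ i : Fin d, (w v).1 i * (w v).2 i))))
        ∂(Measure.pi fun _ : Fin n => featurePair d r) = ENNReal.ofReal V := by
  obtain ⟨V, hV, hV1, hV2⟩ := lint_pair (s.prodCongr (Equiv.refl (Fin d))) hr ht ht1
  refine ⟨V, hV, hV1.trans (le_of_eq ?_), ?_⟩
  · have : (Finset.univ.filter fun p : Fin n × Fin d => (s.prodCongr (Equiv.refl (Fin d))) p ≠ p)
        = (Finset.univ.filter fun v => s v ≠ v) ×ˢ (Finset.univ : Finset (Fin d)) := by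
      ext ⟨v, i⟩; simp
    rw [this, Finset.card_product, hk, Finset.card_univ, Fintype.card_fin]
    push_cast; ring
  · rw [← (mp_feat n d r).lintegral_comp (by fun_prop), ← hV2]
    refine lintegral_congr fun p => ?_
    simp only [Fintype.sum_prod_type, ← Finset.sum_sub_distrib]
    rfl

lemma final_aux
    (n d : ℕ) (ρ r : ℝ)
    (hρ : 0 < ρ ∧ ρ < 1) (hr : 0 < r ∧ r < 1)
    (πs π' : Equiv.Perm (Fin n)) (k : ℕ) (hk : hamming πs π' = k)
    (t : ℝ) (ht : 0 < t) (ht1 : t < 1) :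
    Real.log (∫ o : Obs n d, Real.exp (t *
        (phi ρ * ∑ e : Edge n,
            (o.1 e * o.2.1 (edgeMap π' e) - o.1 e * o.2.1 (edgeMap πs e))
          + phi r * ∑ v : Fin n,
              ((∑ i : Fin d, o.2.2.1 v i * o.2.2.2 (π' v) i)
                - ∑ i : Fin d, o.2.2.1 v i * o.2.2.2 (πs v) i)))
        ∂ obsLaw n d ρ r πs)
      ≤ 1 / 2 * (((n.choose 2 : ℝ) - ((n - k).choose 2 : ℝ)) - (k : ℝ) / 2) *
          (-(1 / 2) * Real.log (1 + ρ ^ 2 / (1 - ρ ^ 2) * (4 * t - 4 * t ^ 2)))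
        + (k : ℝ) / 2 *
          (-((d : ℝ) / 2) * Real.log (1 + r ^ 2 / (1 - r ^ 2) * (4 * t - 4 * t ^ 2))) := by
  have hk' : (Finset.univ.filter fun v => (πs⁻¹ * π') v ≠ v).card = k := by
    rw [← hk, hamming]
    congr 1
    ext v
    simp only [Finset.mem_filter, Finset.mem_univ, true_and, Equiv.Perm.mul_apply, ne_eq,
      Equiv.Perm.inv_eq_iff_eq]
    exact not_congr eq_comm
  obtain ⟨V, hV, hV1, hV2⟩ := edge_final n (πs⁻¹ * π') hρ ht ht1 k hk'
  obtain ⟨W, hW, hW1, hW2⟩ := feat_final n d (πs⁻¹ * π') hr ht ht1 k hk'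
  have hobs : Measurable (obsOf (d := d) πs) := by
    unfold obsOf; fun_prop
  rw [integral_eq_lintegral_of_nonneg_ae (ae_of_all _ fun _ => (Real.exp_pos _).le)
    (Measurable.aestronglyMeasurable (by fun_prop)), obsLaw, lintegral_map (by fun_prop) hobs]
  have : ∀ ω : (Edge n → ℝ × ℝ) × (Fin n → (Fin d → ℝ) × (Fin d → ℝ)),
      ENNReal.ofReal (Real.exp (t *
        (phi ρ * ∑ e : Edge n,
            ((obsOf πs ω).1 e * (obsOf πs ω).2.1 (edgeMap π' e) - (obsOf πs ω).1 e * (obsOf πs ω).2.1 (edgeMap πs e))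
          + phi r * ∑ v : Fin n,
              ((∑ i : Fin d, (obsOf πs ω).2.2.1 v i * (obsOf πs ω).2.2.2 (π' v) i)
                - ∑ i : Fin d, (obsOf πs ω).2.2.1 v i * (obsOf πs ω).2.2.2 (πs v) i))))
      = ENNReal.ofReal (Real.exp (t * (phi ρ * ∑ e : Edge n,
        ((ω.1 e).1 * (ω.1 (edgeMap (πs⁻¹ * π') e)).2 - (ω.1 e).1 * (ω.1 e).2)))) *
        ENNReal.ofReal (Real.exp (t * (phi r * ∑ v : Fin n,
        ((∑ i : Fin d, (ω.2 v).1 i * (ω.2 ((πs⁻¹ * π') v)).2 i) - ∑ i : Fin d, (ω.2 v).1 i * (ω.2 v).2 i)))) := by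
    intro ω
    have hinv : ∀ v, πs⁻¹ (πs v) = v := fun v => πs.symm_apply_apply v
    rw [← ENNReal.ofReal_mul (Real.exp_pos _).le, ← Real.exp_add, ← mul_add]
    simp only [obsOf, edgeMap_mul, inv_mul_cancel, edgeMap_one, Equiv.Perm.mul_apply,
      hinv]
  simp_rw [this]
  rw [sample, lintegral_prod_mul (f := fun w : Edge n → ℝ × ℝ => ENNReal.ofReal (Real.exp (t * (phi ρ * ∑ e : Edge n,
        ((w e).1 * (w (edgeMap (πs⁻¹ * π') e)).2 - (w e).1 * (w e).2)))))
      (g := fun w : Fin n → (Fin d → ℝ) × (Fin d → ℝ) => ENNReal.ofReal (Real.exp (t * (phi r * ∑ v : Fin n,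
        ((∑ i : Fin d, (w v).1 i * (w ((πs⁻¹ * π') v)).2 i) - ∑ i : Fin d, (w v).1 i * (w v).2 i)))))
      (Measurable.aemeasurable (by fun_prop)) (Measurable.aemeasurable (by fun_prop)), hV2, hW2,
    ← ENNReal.ofReal_mul hV.le, ENNReal.toReal_ofReal (by positivity), Real.log_mul hV.ne' hW.ne']
  linarith

open scoped Classical in
/-- Lemma: cumulant bound for the score difference of a
permutation at Hamming distance `k`. For `0 < t < 1`,
`log E[exp(t Y)] ≤ (1/2)(N_k − k/2) μ₂^E(t) + (k/2) μ₂^V(t)`. -/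
theorem cumulant_bound_difference
    (n d : ℕ) (ρ r : ℝ)
    (hρ : 0 < ρ ∧ ρ < 1) (hr : 0 < r ∧ r < 1)
    (πs π' : Equiv.Perm (Fin n)) (k : ℕ) (hk : hamming πs π' = k)
    (t : ℝ) (ht : 0 < t) (ht1 : t < 1) :
    Real.log (∫ o : Obs n d, Real.exp (t *
        (phi ρ * ∑ e ∈ Finset.univ.filter
              (fun e : Edge n => edgeMap π' e ≠ edgeMap πs e),
            (o.1 e * o.2.1 (edgeMap π' e) - o.1 e * o.2.1 (edgeMap πs e))
          + phi r * ∑ v ∈ Finset.univ.filter (fun v : Fin n => π' v ≠ πs v),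
              ((∑ i : Fin d, o.2.2.1 v i * o.2.2.2 (π' v) i)
                - ∑ i : Fin d, o.2.2.1 v i * o.2.2.2 (πs v) i)))
        ∂ obsLaw n d ρ r πs)
      ≤ 1 / 2 * (((n.choose 2 : ℝ) - ((n - k).choose 2 : ℝ)) - (k : ℝ) / 2) *
          (-(1 / 2) * Real.log (1 + ρ ^ 2 / (1 - ρ ^ 2) * (4 * t - 4 * t ^ 2)))
        + (k : ℝ) / 2 *
          (-((d : ℝ) / 2) * Real.log (1 + r ^ 2 / (1 - r ^ 2) * (4 * t - 4 * t ^ 2))) := by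
  have h := final_aux n d ρ r hρ hr πs π' k hk t ht ht1
  have e1 : ∀ o : Obs n d, ∑ e ∈ Finset.univ.filter
        (fun e : Edge n => edgeMap π' e ≠ edgeMap πs e),
        (o.1 e * o.2.1 (edgeMap π' e) - o.1 e * o.2.1 (edgeMap πs e))
      = ∑ e : Edge n, (o.1 e * o.2.1 (edgeMap π' e) - o.1 e * o.2.1 (edgeMap πs e)) := by
    intro o
    refine Finset.sum_subset (Finset.filter_subset _ _) fun e _ he => ?_
    simp only [Finset.mem_filter, Finset.mem_univ, true_and, not_not] at he
    rw [he, sub_self]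
  have e2 : ∀ o : Obs n d, ∑ v ∈ Finset.univ.filter (fun v : Fin n => π' v ≠ πs v),
        ((∑ i : Fin d, o.2.2.1 v i * o.2.2.2 (π' v) i)
          - ∑ i : Fin d, o.2.2.1 v i * o.2.2.2 (πs v) i)
      = ∑ v : Fin n, ((∑ i : Fin d, o.2.2.1 v i * o.2.2.2 (π' v) i)
          - ∑ i : Fin d, o.2.2.1 v i * o.2.2.2 (πs v) i) := by
    intro o
    refine Finset.sum_subset (Finset.filter_subset _ _) fun e _ he => ?_
    simp only [Finset.mem_filter, Finset.mem_univ, true_and, not_not] at he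
    rw [he, sub_self]
  simp_rw [e1, e2]
  exact h

end FCGW
end

section
/- For any positive integer n and any 0 < δ ≤ 1 with m = δn a positive integer, there exists a set M of permutations of {1,…,n} such that any two distinct π, π' ∈ M agree in fewer than m positions (equivalently, their Hamming distance exceeds (1−δ)n), and |M| ≥ m! ≥ (δn/e)^{δn}. -/
open MeasureTheory ProbabilityTheory Filter
open scoped ENNReal

namespace FCGW

lemma card_agree_aux {n : ℕ} (π : Equiv.Perm (Fin n)) (S : Finset (Fin n)) :
    (Finset.univ.filter fun σ : Equiv.Perm (Fin n) => ∀ i ∈ S, π i = σ i).card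
      = (n - S.card).factorial := by
  have e := Equiv.Perm.subtypeEquivSubtypePerm (fun i : Fin n => i ∉ S)
  have h1 : Fintype.card {f : Equiv.Perm (Fin n) // ∀ a, ¬ (a ∉ S) → f a = a}
      = (n - S.card).factorial := by
    rw [← Fintype.card_congr e, Fintype.card_perm, Fintype.card_subtype_compl]
    simp
  rw [← h1, Fintype.card_subtype]
  refine Finset.card_bij (fun σ _ => π⁻¹ * σ) ?_ ?_ ?_
  · intro σ hσ
    simp only [Finset.mem_filter, Finset.mem_univ, true_and, not_not] at hσ ⊢
    intro a ha
    simp [← hσ a ha]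
  · intro a _ b _ h
    exact mul_left_cancel h
  · intro τ hτ
    simp only [Finset.mem_filter, Finset.mem_univ, true_and, not_not] at hτ
    refine ⟨π * τ, ?_, by simp⟩
    simp only [Finset.mem_filter, Finset.mem_univ, true_and]
    intro i hi
    simp [hτ i hi]

lemma exists_packing_aux (n m : ℕ) (hmn : m ≤ n) :
    ∃ M : Finset (Equiv.Perm (Fin n)),
      (∀ π ∈ M, ∀ π' ∈ M, π ≠ π' →
        (Finset.univ.filter fun i => π i = π' i).card < m) ∧
      m.factorial ≤ M.card := by
  classical
  let P : Finset (Finset (Equiv.Perm (Fin n))) := Finset.univ.filter fun M =>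
    ∀ π ∈ M, ∀ π' ∈ M, π ≠ π' → (Finset.univ.filter fun i => π i = π' i).card < m
  have hP : P.Nonempty := ⟨∅, by simp [P]⟩
  obtain ⟨M, hMP, hmax⟩ := Finset.exists_max_image P Finset.card hP
  have hM : ∀ π ∈ M, ∀ π' ∈ M, π ≠ π' →
      (Finset.univ.filter fun i => π i = π' i).card < m := by
    simpa [P] using hMP
  refine ⟨M, hM, ?_⟩
  have hcov : ∀ σ : Equiv.Perm (Fin n), ∃ π ∈ M,
      m ≤ (Finset.univ.filter fun i => π i = σ i).card := by
    intro σ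
    by_contra! hc
    have hσ : σ ∉ M := by
      intro h
      have := hc σ h
      simp at this
      omega
    have hins : insert σ M ∈ P := by
      simp only [P, Finset.mem_filter, Finset.mem_univ, true_and]
      intro a ha b hb hab
      rcases Finset.mem_insert.1 ha with rfl | haM
      · rcases Finset.mem_insert.1 hb with rfl | hb
        · exact absurd rfl hab
        · have := hc b hb
          simpa only [eq_comm] using this
      · rcases Finset.mem_insert.1 hb with rfl | hb
        · exact hc a haM
        · exact hM a haM b hb hab
    have := hmax _ hins
    rw [Finset.card_insert_of_notMem hσ] at this
    omega
  have hsub : (Finset.univ : Finset (Equiv.Perm (Fin n))) ⊆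
      (M ×ˢ Finset.powersetCard m (Finset.univ : Finset (Fin n))).biUnion
        fun p => Finset.univ.filter fun σ : Equiv.Perm (Fin n) => ∀ i ∈ p.2, p.1 i = σ i := by
    intro σ _
    obtain ⟨π, hπ, h⟩ := hcov σ
    obtain ⟨S, hS, hSc⟩ := Finset.exists_subset_card_eq h
    refine Finset.mem_biUnion.2 ⟨(π, S), ?_, ?_⟩
    · simp [hπ, Finset.mem_powersetCard, hSc]
    · simp only [Finset.mem_filter, Finset.mem_univ, true_and]
      intro i hi
      exact (Finset.mem_filter.1 (hS hi)).2
  have hcard := (Finset.card_le_card hsub).trans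
    (Finset.card_biUnion_le_card_mul _ _ (n - m).factorial (by
      rintro ⟨π, S⟩ hp
      have hS : S.card = m := by
        simpa [Finset.mem_powersetCard] using (Finset.mem_product.1 hp).2
      rw [card_agree_aux, hS]))
  rw [Finset.card_univ, Fintype.card_perm, Finset.card_product, Finset.card_powersetCard,
    Finset.card_univ, Fintype.card_fin, ← Nat.choose_mul_factorial_mul_factorial hmn] at hcard
  have hpos : 0 < n.choose m * (n - m).factorial :=
    Nat.mul_pos (Nat.choose_pos hmn) (Nat.factorial_pos _)
  refine Nat.le_of_mul_le_mul_left ?_ hpos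
  calc _ = n.choose m * m.factorial * (n - m).factorial := by ring
    _ ≤ _ := hcard
    _ = _ := by ring

/-- Lemma: packing lower bound. For `m = δ n` a positive
integer, there is a set `M` of permutations of `{1, …, n}` any two distinct
members of which agree in fewer than `m` positions, with
`|M| ≥ m! ≥ (δn/e)^{δn}`. -/
theorem packing_lower_bound
    (n m : ℕ) (δ : ℝ) (hn : 0 < n) (hδ : 0 < δ) (hδ1 : δ ≤ 1)
    (hm : (m : ℝ) = δ * n) (hm0 : 0 < m) :
    ∃ M : Finset (Equiv.Perm (Fin n)),
      (∀ π ∈ M, ∀ π' ∈ M, π ≠ π' →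
        (Finset.univ.filter fun i => π i = π' i).card < m) ∧
      m.factorial ≤ M.card ∧
      (δ * n / Real.exp 1) ^ (δ * (n : ℝ)) ≤ (m.factorial : ℝ) := by
  have hn' : (0 : ℝ) < n := by exact_mod_cast hn
  have hmn : m ≤ n := by
    have : (m : ℝ) ≤ n := by rw [hm]; nlinarith
    exact_mod_cast this
  obtain ⟨M, h1, h2⟩ := exists_packing_aux n m hmn
  refine ⟨M, h1, h2, ?_⟩
  rw [← hm, Real.rpow_natCast, div_pow, ← Real.exp_nat_mul, mul_one,
    div_le_iff₀ (Real.exp_pos _)]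
  have h := Real.pow_div_factorial_le_exp (x := (m : ℝ)) (by positivity) m
  rw [div_le_iff₀ (by positivity)] at h
  linarith

end FCGW
end

section
/- Let r ∈ (0,1), and let (x_i, y_i), 1 ≤ i ≤ n, be independent pairs in ℝ^d × ℝ^d, each distributed N(0, Σ_d) with Σ_d = [[I_d, r I_d],[r I_d, I_d]]. Define D ∈ ℝ^{n×n} by D_{ij} = ‖x_i − y_j‖₂². Then for any 0 < δ < 1, if d > 32·log(n/√δ), with probability at least 1 − δ, min_{1≤i,j≤n} D_{ij} ≥ (1−r)·d. -/
open MeasureTheory ProbabilityTheory Filter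
open scoped ENNReal

namespace FCGW

lemma gauss_lin (a b : ℝ) (v : NNReal) (hv : (v : ℝ) = a ^ 2 + b ^ 2) :
    MeasurePreserving (fun z : ℝ × ℝ => a * z.1 + b * z.2)
      ((gaussianReal 0 1).prod (gaussianReal 0 1)) (gaussianReal 0 v) := by
  refine ⟨by fun_prop, ?_⟩
  have hi : IndepFun (fun z : ℝ × ℝ => a * z.1) (fun z : ℝ × ℝ => b * z.2)
      ((gaussianReal 0 1).prod (gaussianReal 0 1)) :=
    indepFun_prod (X := fun x : ℝ => a * x) (Y := fun x : ℝ => b * x) (by fun_prop) (by fun_prop)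
  have h1 : ((gaussianReal 0 1).prod (gaussianReal 0 1)).map (fun z : ℝ × ℝ => a * z.1)
      = gaussianReal (a * 0) (.mk (a ^ 2) (sq_nonneg _) * 1) := by
    rw [← gaussianReal_map_const_mul]
    have := Measure.map_map (μ := (gaussianReal 0 1).prod (gaussianReal 0 1))
      (g := fun x : ℝ => a * x) (f := Prod.fst) (by fun_prop) (by fun_prop)
    rw [measurePreserving_fst.map_eq] at this
    exact this.symm
  have h2 : ((gaussianReal 0 1).prod (gaussianReal 0 1)).map (fun z : ℝ × ℝ => b * z.2)
      = gaussianReal (b * 0) (.mk (b ^ 2) (sq_nonneg _) * 1) := by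
    rw [← gaussianReal_map_const_mul]
    have := Measure.map_map (μ := (gaussianReal 0 1).prod (gaussianReal 0 1))
      (g := fun x : ℝ => b * x) (f := Prod.snd) (by fun_prop) (by fun_prop)
    rw [measurePreserving_snd.map_eq] at this
    exact this.symm
  have h3 := gaussianReal_add_gaussianReal_of_indepFun hi h1 h2
  have hv' : (NNReal.mk (a ^ 2) (sq_nonneg _) * 1 + NNReal.mk (b ^ 2) (sq_nonneg _) * 1 : NNReal)
      = v := by
    ext
    push_cast
    simp [hv]
  rw [hv', mul_zero, mul_zero, add_zero] at h3
  exact h3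

lemma pi_lin (d : ℕ) (a b : ℝ) (v : NNReal) (hv : (v : ℝ) = a ^ 2 + b ^ 2) :
    MeasurePreserving (fun (z : (Fin d → ℝ) × (Fin d → ℝ)) (i : Fin d) => a * z.1 i + b * z.2 i)
      ((Measure.pi fun _ : Fin d => gaussianReal 0 1).prod
        (Measure.pi fun _ : Fin d => gaussianReal 0 1))
      (Measure.pi fun _ : Fin d => gaussianReal 0 v) := by
  have h1 := (measurePreserving_arrowProdEquivProdArrow ℝ ℝ (Fin d)
    (fun _ => gaussianReal 0 1) (fun _ => gaussianReal 0 1)).symm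
  have h2 := measurePreserving_pi (fun _ : Fin d => (gaussianReal 0 1).prod (gaussianReal 0 1))
    (fun _ : Fin d => gaussianReal 0 v) (fun _ => gauss_lin a b v hv)
  exact h2.comp h1

lemma gauss_laplace (v : NNReal) (hv : v ≠ 0) :
    ∫ x, Real.exp (-(x ^ 2 / (2 * v))) ∂(gaussianReal 0 v) = (Real.sqrt 2)⁻¹ := by
  rw [integral_gaussianReal_eq_integral_smul hv]
  have hv2 : v / 2 ≠ 0 := by positivity
  have hv0 : (0 : ℝ) < v := by positivity
  have : ∀ x : ℝ, gaussianPDFReal 0 v x • Real.exp (-(x ^ 2 / (2 * v)))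
      = (Real.sqrt 2)⁻¹ * gaussianPDFReal 0 (v / 2) x := by
    intro x
    simp only [gaussianPDFReal, smul_eq_mul, sub_zero]
    rw [mul_assoc, ← Real.exp_add, ← mul_assoc, ← mul_inv, ← Real.sqrt_mul (by norm_num)]
    push_cast
    congr 2
    · congr 1; ring
    · field_simp; ring
  simp_rw [this]
  rw [integral_const_mul, integral_gaussianPDFReal_eq_one 0 hv2, mul_one]

lemma sqrt_two_bound : (Real.sqrt 2)⁻¹ ≤ Real.exp (-(5 / 16)) := by
  rw [Real.exp_neg]
  gcongr
  apply Real.le_sqrt_of_sq_le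
  rw [← Real.exp_nat_mul, ← Real.le_log_iff_exp_le (by norm_num)]
  have := Real.log_two_gt_d9
  norm_num at this ⊢
  linarith

lemma chi_tail (d : ℕ) (v : NNReal) (hv : v ≠ 0) (c : ℝ) (hc : c ≤ v * d / 2) :
    (Measure.pi fun _ : Fin d => gaussianReal 0 v) {w | ∑ t, (w t) ^ 2 < c}
      ≤ ENNReal.ofReal (Real.exp (-(d / 16 : ℝ))) := by
  have hv0 : (0 : ℝ) < v := by positivity
  set μ := (Measure.pi fun _ : Fin d => gaussianReal 0 v) with hμ
  set f : (Fin d → ℝ) → ℝ := fun w => ∏ t, Real.exp (-((w t) ^ 2 / (2 * v))) with hf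
  have hint : Integrable f μ := by
    refine Integrable.of_bound (C := 1) ?_ (ae_of_all _ fun w => ?_)
    · exact Measurable.aestronglyMeasurable (by fun_prop)
    · rw [Real.norm_of_nonneg (by positivity)]
      exact Finset.prod_le_one (fun _ _ => by positivity)
        (fun _ _ => Real.exp_le_one_iff.2 (neg_nonpos.2 (by positivity)))
  have h1 := mul_meas_ge_le_integral_of_nonneg (μ := μ) (f := f)
    (ae_of_all _ fun w => by simp only [hf, Pi.zero_apply]; positivity) hint
    (Real.exp (-(d / 4 : ℝ)))
  have h2 : ∫ w, f w ∂μ = (Real.sqrt 2)⁻¹ ^ d := by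
    rw [← gauss_laplace v hv]
    have := integral_fintype_prod_eq_pow (ι := Fin d) (μ := gaussianReal 0 v)
      (fun x : ℝ => Real.exp (-(x ^ 2 / (2 * v))))
    simpa using this
  rw [h2] at h1
  have h3 : (Real.sqrt 2)⁻¹ ^ d ≤ Real.exp (-(5 * d / 16 : ℝ)) := by
    calc _ ≤ (Real.exp (-(5 / 16))) ^ d := by gcongr; exact sqrt_two_bound
      _ = _ := by rw [← Real.exp_nat_mul]; congr 1; ring
  have h4 : μ.real {w | Real.exp (-(d / 4 : ℝ)) ≤ f w} ≤ Real.exp (-(d / 16 : ℝ)) := by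
    have h5 : Real.exp (-(5 * d / 16 : ℝ))
        = Real.exp (-(d / 4 : ℝ)) * Real.exp (-(d / 16 : ℝ)) := by
      rw [← Real.exp_add]; congr 1; ring
    rw [h5] at h3
    exact le_of_mul_le_mul_left (h1.trans h3) (Real.exp_pos _)
  have h6 : {w : Fin d → ℝ | ∑ t, (w t) ^ 2 < c} ⊆ {w | Real.exp (-(d / 4 : ℝ)) ≤ f w} := by
    intro w hw
    simp only [Set.mem_setOf_eq, hf] at hw ⊢
    rw [← Real.exp_sum, Real.exp_le_exp, Finset.sum_neg_distrib, ← Finset.sum_div, neg_le_neg_iff,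
      div_le_iff₀ (by positivity)]
    linarith
  refine (measure_mono h6).trans ?_
  rw [← ofReal_measureReal]
  exact ENNReal.ofReal_le_ofReal h4

instance featurePair_prob (d : ℕ) (r : ℝ) : IsProbabilityMeasure (featurePair d r) :=
  Measure.isProbabilityMeasure_map (by fun_prop)

lemma fst_law (d : ℕ) (r : ℝ) : MeasurePreserving Prod.fst (featurePair d r)
    (Measure.pi fun _ : Fin d => gaussianReal 0 1) := by
  refine ⟨measurable_fst, ?_⟩
  rw [featurePair, Measure.map_map measurable_fst (by fun_prop)]
  exact measurePreserving_fst.map_eq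

lemma snd_law (d : ℕ) (r : ℝ) (hr : 0 < r ∧ r < 1) :
    MeasurePreserving Prod.snd (featurePair d r)
    (Measure.pi fun _ : Fin d => gaussianReal 0 1) := by
  refine ⟨measurable_snd, ?_⟩
  rw [featurePair, Measure.map_map measurable_snd (by fun_prop)]
  refine (pi_lin d r (Real.sqrt (1 - r ^ 2)) 1 ?_).map_eq
  rw [Real.sq_sqrt (by nlinarith)]
  simp

lemma diag_law (d : ℕ) (r : ℝ) (hr : 0 < r ∧ r < 1) :
    MeasurePreserving (fun (p : (Fin d → ℝ) × (Fin d → ℝ)) (t : Fin d) => p.1 t - p.2 t)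
      (featurePair d r)
      (Measure.pi fun _ : Fin d => gaussianReal 0 (Real.toNNReal (2 * (1 - r)))) := by
  refine ⟨by fun_prop, ?_⟩
  rw [featurePair, Measure.map_map (by fun_prop) (by fun_prop)]
  have := (pi_lin d (1 - r) (-Real.sqrt (1 - r ^ 2)) (Real.toNNReal (2 * (1 - r))) ?_).map_eq
  · rw [← this]
    congr 1
    ext z t
    simp only [Function.comp]
    ring
  · rw [neg_sq, Real.sq_sqrt (by nlinarith), Real.coe_toNNReal _ (by linarith)]
    ring

lemma off_law (n d : ℕ) (r : ℝ) (hr : 0 < r ∧ r < 1) (i j : Fin n) (hij : i ≠ j) :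
    MeasurePreserving
      (fun (ω : Fin n → (Fin d → ℝ) × (Fin d → ℝ)) (t : Fin d) => (ω i).1 t - (ω j).2 t)
      (Measure.pi fun _ : Fin n => featurePair d r)
      (Measure.pi fun _ : Fin d => gaussianReal 0 2) := by
  have hind : IndepFun (fun ω : Fin n → (Fin d → ℝ) × (Fin d → ℝ) => ω i) (fun ω => ω j)
      (Measure.pi fun _ : Fin n => featurePair d r) :=
    (iIndepFun_pi (μ := fun _ : Fin n => featurePair d r) (X := fun _ => id)
      (fun _ => aemeasurable_id)).indepFun hij
  have hmap := hind.map_prod_eq_prod_map_map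
    (measurable_pi_apply i).aemeasurable (measurable_pi_apply j).aemeasurable
  have hev : ∀ k : Fin n, (Measure.pi fun _ : Fin n => featurePair d r).map (fun ω => ω k)
      = featurePair d r := fun k =>
    (measurePreserving_eval (fun _ : Fin n => featurePair d r) k).map_eq
  rw [hev, hev] at hmap
  have h1 : MeasurePreserving (fun ω : Fin n → (Fin d → ℝ) × (Fin d → ℝ) => (ω i, ω j))
      (Measure.pi fun _ : Fin n => featurePair d r)
      ((featurePair d r).prod (featurePair d r)) := ⟨by fun_prop, hmap⟩
  have h2 := ((pi_lin d 1 (-1) 2 (by norm_num)).comp ((fst_law d r).prod (snd_law d r hr))).comp h1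
  convert h2 using 1
  ext ω t
  simp [sub_eq_add_neg]

lemma pair_tail (n d : ℕ) (r : ℝ) (hr : 0 < r ∧ r < 1) (i j : Fin n) :
    (Measure.pi fun _ : Fin n => featurePair d r)
        {ω : Fin n → (Fin d → ℝ) × (Fin d → ℝ) |
          ∑ t : Fin d, ((ω i).1 t - (ω j).2 t) ^ 2 < (1 - r) * d}
      ≤ ENNReal.ofReal (Real.exp (-(d / 16 : ℝ))) := by
  have hd : (0 : ℝ) ≤ d := by positivity
  have hS : MeasurableSet {w : Fin d → ℝ | ∑ t, (w t) ^ 2 < (1 - r) * d} :=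
    measurableSet_lt (by fun_prop) (by fun_prop)
  by_cases hij : i = j
  · subst hij
    have h := (diag_law d r hr).comp
      (measurePreserving_eval (fun _ : Fin n => featurePair d r) i)
    have h2 := chi_tail d (Real.toNNReal (2 * (1 - r)))
      (by simpa using hr.2) ((1 - r) * d)
      (by rw [Real.coe_toNNReal _ (by linarith [hr.2])]; linarith)
    rw [← h.measure_preimage hS.nullMeasurableSet] at h2
    exact h2
  · have h := off_law n d r hr i j hij
    have h2 := chi_tail d 2 (by norm_num) ((1 - r) * d) (by push_cast; nlinarith [hr.1])
    rw [← h.measure_preimage hS.nullMeasurableSet] at h2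
    exact h2

/-- Lemma: lower bound on the feature-distance matrix. For
i.i.d. correlated feature pairs `(x_i, y_i) ∼ N(0, Σ_d)` and
`D_{ij} = ‖x_i − y_j‖²`, if `d > 32 log(n/√δ)`, then with probability at least
`1 − δ`, `min_{i,j} D_{ij} ≥ (1 − r) d`. -/
theorem feature_distance_lower_bound
    (n d : ℕ) (r δ : ℝ) (hr : 0 < r ∧ r < 1) (hδ : 0 < δ ∧ δ < 1)
    (hd : 32 * Real.log ((n : ℝ) / Real.sqrt δ) < (d : ℝ)) :
    1 - ENNReal.ofReal δ ≤
      (Measure.pi fun _ : Fin n => featurePair d r)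
        {ω : Fin n → (Fin d → ℝ) × (Fin d → ℝ) |
          ∀ i j : Fin n, (1 - r) * d ≤ ∑ t : Fin d, ((ω i).1 t - (ω j).2 t) ^ 2} := by
  set μ := (Measure.pi fun _ : Fin n => featurePair d r) with hμ
  set s := {ω : Fin n → (Fin d → ℝ) × (Fin d → ℝ) |
          ∀ i j : Fin n, (1 - r) * d ≤ ∑ t : Fin d, ((ω i).1 t - (ω j).2 t) ^ 2} with hs
  have hsub : sᶜ ⊆ ⋃ i : Fin n, ⋃ j : Fin n, {ω : Fin n → (Fin d → ℝ) × (Fin d → ℝ) |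
          ∑ t : Fin d, ((ω i).1 t - (ω j).2 t) ^ 2 < (1 - r) * d} := by
    intro ω hω
    simpa [hs] using hω
  have hbad : μ sᶜ ≤ ENNReal.ofReal δ := by
    calc μ sᶜ ≤ _ := measure_mono hsub
      _ ≤ ∑ i : Fin n, ∑ j : Fin n, μ {ω : Fin n → (Fin d → ℝ) × (Fin d → ℝ) |
          ∑ t : Fin d, ((ω i).1 t - (ω j).2 t) ^ 2 < (1 - r) * d} :=
        (measure_iUnion_fintype_le _ _).trans
          (Finset.sum_le_sum fun i _ => measure_iUnion_fintype_le _ _)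
      _ ≤ ∑ i : Fin n, ∑ j : Fin n, ENNReal.ofReal (Real.exp (-(d / 16 : ℝ))) :=
        Finset.sum_le_sum fun i _ => Finset.sum_le_sum fun j _ => pair_tail n d r hr i j
      _ = ENNReal.ofReal (n * (n * Real.exp (-(d / 16 : ℝ)))) := by
        rw [ENNReal.ofReal_mul (by positivity), ENNReal.ofReal_mul (by positivity)]
        simp
      _ ≤ ENNReal.ofReal δ := by
        apply ENNReal.ofReal_le_ofReal
        rcases Nat.eq_zero_or_pos n with h0 | hn
        · simp [h0, hδ.1.le]
        have hn' : (0 : ℝ) < n := by exact_mod_cast hn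
        have hlog : Real.log ((n : ℝ) / Real.sqrt δ) = Real.log n - Real.log δ / 2 := by
          rw [Real.log_div hn'.ne' (Real.sqrt_pos.2 hδ.1).ne', Real.log_sqrt hδ.1.le]
        rw [hlog] at hd
        have e1 : (n : ℝ) * (n * Real.exp (-(d / 16 : ℝ)))
            = Real.exp (Real.log n + (Real.log n + -(d / 16 : ℝ))) := by
          rw [Real.exp_add, Real.exp_add, Real.exp_log hn']
        rw [e1, ← Real.le_log_iff_exp_le hδ.1]
        linarith
  rw [tsub_le_iff_right]
  calc (1 : ℝ≥0∞) = μ Set.univ := by simp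
    _ = μ (s ∪ sᶜ) := by rw [Set.union_compl_self]
    _ ≤ μ s + μ sᶜ := measure_union_le _ _
    _ ≤ μ s + ENNReal.ofReal δ := by gcongr

end FCGW
end
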